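/- For any nonnegative integer r, ζ({2}^r, 3) = (-4·π^{2r+2}/(2r+2)!) · ∑_{n=0}^{∞} ζ(2n) / ((2n+2r+2)(2n+2r+3)·2^{2n}). -/

import Mathlib

/-- The multiple zeta value `ζ(s₁,…,s_l) = ∑_{1 ≤ k₁ < ⋯ < k_l} ∏ 1/kᵢ^{sᵢ}`. -/
noncomputable def MZV (s : List ℕ) : ℝ :=
  ∑' f : {f : Fin s.length → ℕ+ // StrictMono f},
    ∏ i : Fin s.length, (1 : ℝ) / ((f.1 i : ℕ) : ℝ) ^ s.get i

/-- The multiple t-value `t(s₁,…,s_l) = ∑_{1 ≤ k₁ < ⋯ < k_l} ∏ 1/(2kᵢ-1)^{sᵢ}`. -/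
noncomputable def MTV (s : List ℕ) : ℝ :=
  ∑' f : {f : Fin s.length → ℕ+ // StrictMono f},
    ∏ i : Fin s.length, (1 : ℝ) / ((2 * (f.1 i : ℕ) - 1 : ℕ) : ℝ) ^ s.get i

/-- The truncated multiple zeta value `∑_{1 ≤ k₁ < ⋯ < k_m ≤ n} ∏ 1/kᵢ²`. -/
noncomputable def truncZetaTwos : ℕ → ℕ → ℝ
  | 0, _ => 1
  | m + 1, n => ∑ j ∈ Finset.range n, truncZetaTwos m j / ((j : ℝ) + 1) ^ 2

lemma truncZetaTwos_zero (n : ℕ) : truncZetaTwos 0 n = 1 := rfl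

lemma truncZetaTwos_succ (m n : ℕ) : truncZetaTwos (m + 1) n =
    ∑ j ∈ Finset.range n, truncZetaTwos m j / ((j : ℝ) + 1) ^ 2 := rfl

lemma truncZetaTwos_nonneg (m n : ℕ) : 0 ≤ truncZetaTwos m n := by
  induction m generalizing n with
  | zero => simp [truncZetaTwos_zero]
  | succ m ih =>
    rw [truncZetaTwos_succ]
    exact Finset.sum_nonneg fun j _ => div_nonneg (ih j) (by positivity)

lemma truncZetaTwos_le (m n : ℕ) : truncZetaTwos m n ≤ (n : ℝ) ^ m := by
  induction m generalizing n with
  | zero => simp [truncZetaTwos_zero]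
  | succ m ih =>
    rw [truncZetaTwos_succ]
    calc ∑ j ∈ Finset.range n, truncZetaTwos m j / ((j : ℝ) + 1) ^ 2
        ≤ ∑ j ∈ Finset.range n, (n : ℝ) ^ m := by
          refine Finset.sum_le_sum fun j hj => ?_
          have hjn : (j : ℝ) ≤ n := by exact_mod_cast (Finset.mem_range.1 hj).le
          refine (div_le_self (truncZetaTwos_nonneg m j) ?_).trans
            ((ih j).trans (pow_le_pow_left₀ (by positivity) hjn m))
          exact one_le_pow₀ (by linarith [(Nat.cast_nonneg j : (0 : ℝ) ≤ j)])
      _ = (n : ℝ) ^ (m + 1) := by simp [pow_succ, mul_comm]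

/-- A strictly increasing tuple whose last entry satisfies `P` amounts to its last entry `k`
together with a strictly increasing tuple bounded by `k`. -/
def strictMonoSnocEquiv (m : ℕ) (P : ℕ → Prop) :
    (Σ k : {k : ℕ // P k}, {g : Fin m → ℕ+ // StrictMono g ∧ ∀ i, (g i : ℕ) < k + 1}) ≃
      {f : Fin (m + 1) → ℕ+ // StrictMono f ∧ P ((f (Fin.last m) : ℕ) - 1)} where
  toFun x := ⟨Fin.snoc (α := fun _ => ℕ+) x.2.1 (Nat.succPNat x.1.1), by
    constructor
    · intro i j hij
      induction j using Fin.lastCases with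
      | last =>
        induction i using Fin.lastCases with
        | last => exact absurd hij (lt_irrefl _)
        | cast i =>
          simp only [Fin.snoc_castSucc, Fin.snoc_last]
          rw [← PNat.coe_lt_coe]
          exact x.2.2.2 i
      | cast j =>
        induction i using Fin.lastCases with
        | last => exact absurd hij (not_lt.2 (Fin.le_last _))
        | cast i =>
          simp only [Fin.snoc_castSucc]
          exact x.2.2.1 (by simpa using hij)
    · simpa using x.1.2⟩
  invFun f := ⟨⟨(f.1 (Fin.last m) : ℕ) - 1, f.2.2⟩, ⟨Fin.init f.1, by
    refine ⟨f.2.1.comp Fin.strictMono_castSucc, fun i => ?_⟩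
    have h : (f.1 i.castSucc : ℕ) < f.1 (Fin.last m) :=
      PNat.coe_lt_coe _ _ |>.2 (f.2.1 (Fin.castSucc_lt_last i))
    simp only [Fin.init]
    omega⟩⟩
  left_inv := by
    rintro ⟨⟨k, hk⟩, ⟨g, hg⟩⟩
    refine Sigma.subtype_ext (Subtype.ext ?_) ?_
    · simp
    · simp
  right_inv := by
    rintro ⟨f, hf⟩
    apply Subtype.ext
    have : Nat.succPNat ((f (Fin.last m) : ℕ) - 1) = f (Fin.last m) := by
      apply PNat.eq
      have := (f (Fin.last m)).pos
      simp only [Nat.succPNat_coe]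
      omega
    simp only [this, Fin.snoc_init_self]

lemma hasSum_sigma_of_nonneg {α : Type*} {β : α → Type*} {f : (Σ x, β x) → ℝ}
    (hf : ∀ x, 0 ≤ f x) {g : α → ℝ} {a : ℝ} (hg : ∀ x, HasSum (fun y => f ⟨x, y⟩) (g x))
    (ha : HasSum g a) : HasSum f a := by
  refine ha.sigma_of_hasSum hg ((summable_sigma_of_nonneg hf).2 ⟨fun x => (hg x).summable, ?_⟩)
  simpa only [(hg _).tsum_eq] using ha.summable

lemma hasSum_truncZetaTwos (m n : ℕ) :
    HasSum (fun g : {g : Fin m → ℕ+ // StrictMono g ∧ ∀ i, (g i : ℕ) < n + 1} =>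
      ∏ i, (1 : ℝ) / ((g.1 i : ℕ) : ℝ) ^ 2) (truncZetaTwos m n) := by
  induction m generalizing n with
  | zero =>
    have : Unique {g : Fin 0 → ℕ+ // StrictMono g ∧ ∀ i, (g i : ℕ) < n + 1} :=
      ⟨⟨⟨Fin.elim0, fun i => i.elim0, fun i => i.elim0⟩⟩, fun x =>
        Subtype.ext (Subsingleton.elim _ _)⟩
    simpa only [truncZetaTwos_zero, Finset.univ_eq_empty, Finset.prod_empty] using hasSum_unique
      (fun g : {g : Fin 0 → ℕ+ // StrictMono g ∧ ∀ i, (g i : ℕ) < n + 1} =>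
        ∏ i, (1 : ℝ) / ((g.1 i : ℕ) : ℝ) ^ 2)
  | succ m ih =>
    have key : ∀ f : Fin (m + 1) → ℕ+, (StrictMono f ∧ ∀ i, (f i : ℕ) < n + 1) ↔
        (StrictMono f ∧ (f (Fin.last m) : ℕ) - 1 ∈ Finset.range n) := by
      refine fun f => and_congr_right fun hf => ?_
      have hpos := (f (Fin.last m)).pos
      rw [Finset.mem_range]
      refine ⟨fun h => ?_, fun h i => ?_⟩
      · have := h (Fin.last m)
        omega
      · have : (f i : ℕ) ≤ f (Fin.last m) :=
          PNat.coe_le_coe _ _ |>.2 (hf.monotone (Fin.le_last i))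
        omega
    rw [← (Equiv.subtypeEquivRight key).symm.hasSum_iff,
      ← (strictMonoSnocEquiv m (· ∈ Finset.range n)).hasSum_iff]
    refine hasSum_sigma_of_nonneg
      (g := fun k : {k // k ∈ Finset.range n} => truncZetaTwos m k / ((k : ℝ) + 1) ^ 2)
      (fun x => ?_) (fun k => ?_) ?_
    · simp only [Function.comp_apply]
      positivity
    · convert! (ih k).mul_right (1 / ((k : ℝ) + 1) ^ 2) using 1
      · funext g
        simp [Fin.prod_univ_castSucc, strictMonoSnocEquiv, mul_comm]
      · ring
    · rw [truncZetaTwos_succ, ← Finset.sum_coe_sort]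
      exact hasSum_fintype _

lemma MZV_eq_tsum_of_length {s : List ℕ} {l : ℕ} (h : s.length = l) :
    MZV s = ∑' f : {f : Fin l → ℕ+ // StrictMono f},
      ∏ i : Fin l, (1 : ℝ) / ((f.1 i : ℕ) : ℝ) ^ s.get (Fin.cast h.symm i) := by
  subst h
  rfl

lemma MZV_twos_three (r : ℕ) {a : ℝ}
    (ha : HasSum (fun n : ℕ => truncZetaTwos r n / ((n : ℝ) + 1) ^ 3) a) :
    MZV (List.replicate r 2 ++ [3]) = a := by
  rw [MZV_eq_tsum_of_length (l := r + 1) (by simp)]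
  refine HasSum.tsum_eq ?_
  rw [← (Equiv.subtypeEquivRight (p := fun f : Fin (r + 1) → ℕ+ => StrictMono f ∧ True)
      (fun f => iff_of_eq (and_true _))).hasSum_iff,
    ← (strictMonoSnocEquiv r (fun _ => True)).hasSum_iff]
  refine hasSum_sigma_of_nonneg
    (g := fun k : {_k : ℕ // True} => truncZetaTwos r k / ((k : ℝ) + 1) ^ 3)
    (fun x => ?_) (fun k => ?_) ?_
  · simp only [Function.comp_apply]
    positivity
  · convert! (hasSum_truncZetaTwos r k).mul_right (1 / ((k : ℝ) + 1) ^ 3) using 1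
    · funext g
      simp [Fin.prod_univ_castSucc, strictMonoSnocEquiv, List.getElem_append, mul_comm]
    · ring
  · exact (Equiv.subtypeUnivEquiv (p := fun _ : ℕ => True) (fun _ => trivial)).hasSum_iff
      (f := fun n : ℕ => truncZetaTwos r n / ((n : ℝ) + 1) ^ 3) |>.2 ha

/-- The coefficients `4 ^ (k + 1) * k! ^ 2 / (2 * k + 2)!` of the expansion of `2 * arcsin² x` in
powers of `x²`. -/
noncomputable def arcsinCoeff : ℕ → ℝ
  | 0 => 2
  | k + 1 => arcsinCoeff k * (2 * ((k : ℝ) + 1) ^ 2 / ((2 * k + 3) * (k + 2)))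

lemma arcsinCoeff_succ (k : ℕ) : arcsinCoeff (k + 1) =
    arcsinCoeff k * (2 * ((k : ℝ) + 1) ^ 2 / ((2 * k + 3) * (k + 2))) := rfl

lemma arcsinCoeff_pos (k : ℕ) : 0 < arcsinCoeff k := by
  induction k with
  | zero => norm_num [arcsinCoeff]
  | succ k ih =>
    rw [arcsinCoeff_succ]
    positivity

/-- The coefficients of the second derivative of the expansion of `2 * arcsin² x`. -/
noncomputable def arcsinCoeffDeriv (k : ℕ) : ℝ := arcsinCoeff k * ((2 * k + 2) * (2 * k + 1))

lemma arcsinCoeffDeriv_zero : arcsinCoeffDeriv 0 = 4 := by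
  norm_num [arcsinCoeffDeriv, arcsinCoeff]

lemma arcsinCoeffDeriv_succ (k : ℕ) :
    arcsinCoeffDeriv (k + 1) = 4 * ((k : ℝ) + 1) ^ 2 * arcsinCoeff k := by
  rw [arcsinCoeffDeriv, arcsinCoeff_succ]
  push_cast
  field_simp
  ring

lemma arcsinCoeffDeriv_nonneg (k : ℕ) : 0 ≤ arcsinCoeffDeriv k :=
  mul_nonneg (arcsinCoeff_pos k).le (by positivity)

lemma arcsinCoeffDeriv_le (k : ℕ) : arcsinCoeffDeriv k ≤ 4 * ((k : ℝ) + 1) := by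
  induction k with
  | zero => simp [arcsinCoeffDeriv_zero]
  | succ k ih =>
    have h : arcsinCoeff k * (2 * k + 1) ≤ 2 := by
      rw [arcsinCoeffDeriv] at ih
      have hk : (0 : ℝ) < k + 1 := by positivity
      refine le_of_mul_le_mul_right ?_ hk
      linarith
    rw [arcsinCoeffDeriv_succ]
    push_cast
    nlinarith [mul_le_mul_of_nonneg_right h (by positivity : (0 : ℝ) ≤ k + 2),
      mul_nonneg (arcsinCoeff_pos k).le (Nat.cast_nonneg k : (0 : ℝ) ≤ k)]

/-- The partial sums of the expansion of `(2θ) ^ (2m+2) / (2m+2)!` in powers of `sin² θ`. -/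
noncomputable def sinSeries (m N : ℕ) (θ : ℝ) : ℝ :=
  ∑ k ∈ Finset.range N, arcsinCoeff k * truncZetaTwos m k * Real.sin θ ^ (2 * k + 2)

/-- The derivative of `sinSeries m N`. -/
noncomputable def sinSeriesDeriv (m N : ℕ) (θ : ℝ) : ℝ :=
  ∑ k ∈ Finset.range N, arcsinCoeff k * truncZetaTwos m k *
    ((2 * k + 2) * Real.sin θ ^ (2 * k + 1) * Real.cos θ)

lemma sinSeries_nonneg (m N : ℕ) (θ : ℝ) : 0 ≤ sinSeries m N θ :=
  Finset.sum_nonneg fun k _ => mul_nonneg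
    (mul_nonneg (arcsinCoeff_pos k).le (truncZetaTwos_nonneg m k))
    ((Even.add (even_two_mul k) even_two).pow_nonneg _)

lemma hasDerivAt_sinSeries (m N : ℕ) (θ : ℝ) :
    HasDerivAt (sinSeries m N) (sinSeriesDeriv m N θ) θ := by
  refine HasDerivAt.fun_sum fun k _ => HasDerivAt.const_mul _ ?_
  have h := (Real.hasDerivAt_sin θ).fun_pow (2 * k + 2)
  convert! h using 1
  push_cast
  simp

lemma hasDerivAt_sinSeriesDeriv_sum (m N : ℕ) (θ : ℝ) :
    HasDerivAt (sinSeriesDeriv m N) (∑ k ∈ Finset.range N, truncZetaTwos m k *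
      (arcsinCoeffDeriv k * Real.sin θ ^ (2 * k) -
        arcsinCoeffDeriv (k + 1) * Real.sin θ ^ (2 * k + 2))) θ := by
  refine HasDerivAt.fun_sum fun k _ => ?_
  have h := ((((Real.hasDerivAt_sin θ).fun_pow (2 * k + 1)).const_mul (2 * (k : ℝ) + 2)).mul
    (Real.hasDerivAt_cos θ)).const_mul (arcsinCoeff k * truncZetaTwos m k)
  convert! h using 1
  rw [arcsinCoeffDeriv_succ, arcsinCoeffDeriv]
  push_cast
  have hc : Real.cos θ * Real.cos θ = 1 - Real.sin θ ^ 2 := by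
    rw [← Real.cos_sq']; ring
  linear_combination (-(arcsinCoeff k * truncZetaTwos m k * (2 * (k : ℝ) + 2) * (2 * k + 1) *
    Real.sin θ ^ (2 * k))) * hc

lemma hasDerivAt_sinSeriesDeriv_zero (N : ℕ) (θ : ℝ) :
    HasDerivAt (sinSeriesDeriv 0 N)
      (4 - arcsinCoeffDeriv N * truncZetaTwos 0 N * Real.sin θ ^ (2 * N)) θ := by
  convert! hasDerivAt_sinSeriesDeriv_sum 0 N θ using 1
  induction N with
  | zero => simp [arcsinCoeffDeriv_zero, truncZetaTwos_zero]
  | succ N ih =>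
    rw [Finset.sum_range_succ, ← ih]
    simp only [truncZetaTwos_zero]
    ring

lemma hasDerivAt_sinSeriesDeriv_succ (m N : ℕ) (θ : ℝ) :
    HasDerivAt (sinSeriesDeriv (m + 1) N)
      (4 * sinSeries m N θ -
        arcsinCoeffDeriv N * truncZetaTwos (m + 1) N * Real.sin θ ^ (2 * N)) θ := by
  convert! hasDerivAt_sinSeriesDeriv_sum (m + 1) N θ using 1
  induction N with
  | zero => simp [sinSeries, truncZetaTwos_succ]
  | succ N ih =>
    rw [Finset.sum_range_succ, ← ih, arcsinCoeffDeriv_succ, sinSeries, sinSeries,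
      truncZetaTwos_succ m (N + 1), truncZetaTwos_succ m N, Finset.sum_range_succ,
      Finset.sum_range_succ]
    field_simp
    ring

/-- The remainder of the expansion of `(2θ) ^ (2m+2) / (2m+2)!` in powers of `sin² θ`. -/
noncomputable def sinRemainder (m N : ℕ) (θ : ℝ) : ℝ :=
  (2 * θ) ^ (2 * m + 2) / (2 * m + 2).factorial - sinSeries m N θ

/-- The derivative of `sinRemainder m N`. -/
noncomputable def sinRemainderDeriv (m N : ℕ) (θ : ℝ) : ℝ :=
  2 * (2 * θ) ^ (2 * m + 1) / (2 * m + 1).factorial - sinSeriesDeriv m N θ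

lemma hasDerivAt_two_mul_pow_div_factorial (n : ℕ) (θ : ℝ) :
    HasDerivAt (fun θ : ℝ => (2 * θ) ^ (n + 1) / (n + 1).factorial)
      (2 * (2 * θ) ^ n / n.factorial) θ := by
  have h := (((hasDerivAt_id θ).const_mul 2).fun_pow (n + 1)).div_const ((n + 1).factorial : ℝ)
  convert! h using 1
  rw [Nat.factorial_succ]
  push_cast
  simp only [id]
  field_simp

lemma hasDerivAt_sinRemainder (m N : ℕ) (θ : ℝ) :
    HasDerivAt (sinRemainder m N) (sinRemainderDeriv m N θ) θ :=
  (hasDerivAt_two_mul_pow_div_factorial (2 * m + 1) θ).sub (hasDerivAt_sinSeries m N θ)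

lemma hasDerivAt_sinRemainderDeriv_zero (N : ℕ) (θ : ℝ) :
    HasDerivAt (sinRemainderDeriv 0 N)
      (arcsinCoeffDeriv N * truncZetaTwos 0 N * Real.sin θ ^ (2 * N)) θ := by
  have h := ((hasDerivAt_two_mul_pow_div_factorial 0 θ).const_mul 2).sub
    (hasDerivAt_sinSeriesDeriv_zero N θ)
  convert! h using 1
  · funext x
    simp [sinRemainderDeriv]
  · simp
    ring

lemma hasDerivAt_sinRemainderDeriv_succ (m N : ℕ) (θ : ℝ) :
    HasDerivAt (sinRemainderDeriv (m + 1) N) (4 * sinRemainder m N θ +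
      arcsinCoeffDeriv N * truncZetaTwos (m + 1) N * Real.sin θ ^ (2 * N)) θ := by
  have h := ((hasDerivAt_two_mul_pow_div_factorial (2 * m + 2) θ).const_mul 2).sub
    (hasDerivAt_sinSeriesDeriv_succ m N θ)
  convert! h using 1
  · funext x
    simp only [sinRemainderDeriv, Pi.sub_apply, mul_div_assoc]
    ring_nf
  · rw [sinRemainder]
    ring

lemma sinRemainder_zero_right (m N : ℕ) : sinRemainder m N 0 = 0 := by
  simp [sinRemainder, sinSeries]

lemma sinRemainderDeriv_zero_right (m N : ℕ) : sinRemainderDeriv m N 0 = 0 := by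
  simp [sinRemainderDeriv, sinSeriesDeriv]

lemma nonneg_of_hasDerivAt_nonneg {f f' : ℝ → ℝ} {a : ℝ} (hf : ∀ x, HasDerivAt f (f' x) x)
    (h0 : f 0 = 0) (hf' : ∀ x ∈ Set.Icc 0 a, 0 ≤ f' x) {x : ℝ} (hx : x ∈ Set.Icc 0 a) :
    0 ≤ f x := by
  have hmono : MonotoneOn f (Set.Icc 0 a) :=
    monotoneOn_of_deriv_nonneg (convex_Icc 0 a)
      (fun y _ => (hf y).continuousAt.continuousWithinAt)
      (fun y _ => (hf y).differentiableAt.differentiableWithinAt)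
      (fun y hy => (hf y).deriv ▸ hf' y (interior_subset hy))
  exact h0 ▸ hmono ⟨le_rfl, hx.1.trans hx.2⟩ hx hx.1

lemma nonneg_and_le_of_second_deriv {f f' f'' : ℝ → ℝ} {a M : ℝ}
    (hf : ∀ x, HasDerivAt f (f' x) x) (hf' : ∀ x, HasDerivAt f' (f'' x) x)
    (h0 : f 0 = 0) (h0' : f' 0 = 0) (hf'' : ∀ x ∈ Set.Icc 0 a, 0 ≤ f'' x ∧ f'' x ≤ M)
    {x : ℝ} (hx : x ∈ Set.Icc 0 a) : 0 ≤ f x ∧ f x ≤ M * a ^ 2 / 2 := by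
  have lower : ∀ y ∈ Set.Icc 0 a, 0 ≤ f' y := fun y hy =>
    nonneg_of_hasDerivAt_nonneg hf' h0' (fun z hz => (hf'' z hz).1) hy
  have upper : ∀ y ∈ Set.Icc 0 a, 0 ≤ M * y - f' y := fun y hy =>
    nonneg_of_hasDerivAt_nonneg (f := fun y => M * y - f' y) (f' := fun y => M * 1 - f'' y)
      (fun z => ((hasDerivAt_id z).const_mul M).sub (hf' z)) (by simp [h0'])
      (fun z hz => by linarith [(hf'' z hz).2]) hy
  have hM : 0 ≤ M := (hf'' x hx).1.trans (hf'' x hx).2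
  refine ⟨nonneg_of_hasDerivAt_nonneg hf h0 lower hx, ?_⟩
  have key : 0 ≤ M * x ^ 2 / 2 - f x :=
    nonneg_of_hasDerivAt_nonneg (f := fun y => M * y ^ 2 / 2 - f y)
      (f' := fun y => M * y - f' y)
      (fun z => by
        convert! ((((hasDerivAt_id z).fun_pow 2).const_mul M).div_const 2).sub (hf z) using 1
        simp
        ring) (by simp [h0]) upper hx
  have : x ^ 2 ≤ a ^ 2 := pow_le_pow_left₀ hx.1 hx.2 2
  nlinarith

lemma sinRemainder_bound (m : ℕ) {a : ℝ} (ha0 : 0 ≤ a) (ha : a ≤ Real.pi / 2) :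
    ∃ C : ℝ, ∀ N : ℕ, ∀ θ ∈ Set.Icc 0 a, 0 ≤ sinRemainder m N θ ∧
      sinRemainder m N θ ≤ C * (((N : ℝ) + 1) ^ (m + 1) * (Real.sin a ^ 2) ^ N) := by
  have hδ0 : ∀ m N θ, 0 ≤ arcsinCoeffDeriv N * truncZetaTwos m N * Real.sin θ ^ (2 * N) :=
    fun m N θ => mul_nonneg (mul_nonneg (arcsinCoeffDeriv_nonneg N) (truncZetaTwos_nonneg m N))
      ((even_two_mul N).pow_nonneg _)
  have hδ : ∀ m N, ∀ θ ∈ Set.Icc 0 a,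
      arcsinCoeffDeriv N * truncZetaTwos m N * Real.sin θ ^ (2 * N) ≤
        4 * (((N : ℝ) + 1) ^ (m + 1) * (Real.sin a ^ 2) ^ N) := by
    intro m N θ hθ
    have h1 : Real.sin θ ^ (2 * N) ≤ (Real.sin a ^ 2) ^ N := by
      rw [← pow_mul]
      refine pow_le_pow_left₀ (Real.sin_nonneg_of_nonneg_of_le_pi hθ.1
        (by linarith [hθ.2, Real.pi_pos])) ?_ _
      exact Real.sin_le_sin_of_le_of_le_pi_div_two (by linarith [hθ.1, Real.pi_pos]) ha hθ.2
    have h2 : truncZetaTwos m N ≤ ((N : ℝ) + 1) ^ m :=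
      (truncZetaTwos_le m N).trans (pow_le_pow_left₀ (by positivity) (by linarith) m)
    calc _ ≤ (4 * ((N : ℝ) + 1)) * ((N : ℝ) + 1) ^ m * (Real.sin a ^ 2) ^ N :=
          mul_le_mul (mul_le_mul (arcsinCoeffDeriv_le N) h2 (truncZetaTwos_nonneg m N)
            (by positivity)) h1 ((even_two_mul N).pow_nonneg _) (by positivity)
      _ = _ := by ring
  induction m with
  | zero =>
    refine ⟨4 * a ^ 2 / 2, fun N θ hθ => ?_⟩
    have h := nonneg_and_le_of_second_deriv (hasDerivAt_sinRemainder 0 N)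
      (hasDerivAt_sinRemainderDeriv_zero N) (sinRemainder_zero_right 0 N)
      (sinRemainderDeriv_zero_right 0 N) (fun x hx => ⟨hδ0 0 N x, hδ 0 N x hx⟩) hθ
    exact ⟨h.1, h.2.trans_eq (by ring)⟩
  | succ m ih =>
    obtain ⟨C, hC⟩ := ih
    refine ⟨(4 * |C| + 4) * a ^ 2 / 2, fun N θ hθ => ?_⟩
    have hle : ∀ x ∈ Set.Icc 0 a, sinRemainder m N x ≤
        |C| * (((N : ℝ) + 1) ^ (m + 1 + 1) * (Real.sin a ^ 2) ^ N) := by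
      intro x hx
      refine (hC N x hx).2.trans (mul_le_mul (le_abs_self C) ?_ (by positivity) (abs_nonneg C))
      refine mul_le_mul_of_nonneg_right (pow_le_pow_right₀ ?_ (by omega)) (by positivity)
      linarith [(Nat.cast_nonneg N : (0 : ℝ) ≤ N)]
    have h := nonneg_and_le_of_second_deriv (hasDerivAt_sinRemainder (m + 1) N)
      (hasDerivAt_sinRemainderDeriv_succ m N) (sinRemainder_zero_right (m + 1) N)
      (sinRemainderDeriv_zero_right (m + 1) N)
      (M := (4 * |C| + 4) * (((N : ℝ) + 1) ^ (m + 1 + 1) * (Real.sin a ^ 2) ^ N))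
      (fun x hx => ⟨by linarith [hδ0 (m + 1) N x, (hC N x hx).1],
        by linarith [hδ (m + 1) N x hx, hle x hx]⟩) hθ
    exact ⟨h.1, h.2.trans_eq (by ring)⟩

lemma sinRemainder_nonneg (m N : ℕ) {θ : ℝ} (h0 : 0 ≤ θ) (h1 : θ ≤ Real.pi / 2) :
    0 ≤ sinRemainder m N θ := by
  obtain ⟨C, hC⟩ := sinRemainder_bound m h0 h1
  exact (hC N θ ⟨h0, le_rfl⟩).1

lemma tendsto_sinRemainder (m : ℕ) {θ : ℝ} (h0 : 0 ≤ θ) (h1 : θ < Real.pi / 2) :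
    Filter.Tendsto (fun N => sinRemainder m N θ) Filter.atTop (nhds 0) := by
  obtain ⟨C, hC⟩ := sinRemainder_bound m h0 h1.le
  have hs0 : 0 ≤ Real.sin θ := Real.sin_nonneg_of_nonneg_of_le_pi h0 (by linarith [Real.pi_pos])
  have hs1 : Real.sin θ < 1 := by
    rw [← Real.sin_pi_div_two]
    exact Real.sin_lt_sin_of_lt_of_le_pi_div_two (by linarith [Real.pi_pos]) le_rfl h1
  have hq1 : Real.sin θ ^ 2 < 1 := pow_lt_one₀ hs0 hs1 (by norm_num)
  have hlim : Filter.Tendsto (fun N : ℕ => C * (((N : ℝ) + 1) ^ (m + 1) * (Real.sin θ ^ 2) ^ N))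
      Filter.atTop (nhds 0) := by
    have hp : Filter.Tendsto (fun N : ℕ => ((N : ℝ) + 1) ^ (m + 1) * (Real.sin θ ^ 2) ^ N)
        Filter.atTop (nhds 0) := by
      have hbase := (tendsto_pow_const_mul_const_pow_of_lt_one (m + 1) (sq_nonneg (Real.sin θ))
        hq1).const_mul (2 ^ (m + 1))
      have hgeo := tendsto_pow_atTop_nhds_zero_of_lt_one (sq_nonneg (Real.sin θ)) hq1
      have hadd := hbase.add hgeo
      rw [mul_zero, add_zero] at hadd
      refine squeeze_zero (fun N => by positivity) (fun N => ?_) hadd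
      rw [← mul_assoc, ← mul_pow, ← add_one_mul]
      refine mul_le_mul_of_nonneg_right ?_ (by positivity)
      rcases Nat.eq_zero_or_pos N with rfl | hN
      · simp
      · have : (1 : ℝ) ≤ N := by exact_mod_cast hN
        linarith [pow_le_pow_left₀ (by positivity : (0 : ℝ) ≤ N + 1)
          (by linarith : (N : ℝ) + 1 ≤ 2 * N) (m + 1)]
    simpa using hp.const_mul C
  exact squeeze_zero (fun N => (hC N θ ⟨h0, le_rfl⟩).1) (fun N => (hC N θ ⟨h0, le_rfl⟩).2) hlim

/-- The real values `ζ(2n)`, with `ζ(0) = -1/2`. -/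
noncomputable def zetaEven (n : ℕ) : ℝ :=
  if n = 0 then -1 / 2 else ∑' k : ℕ, 1 / ((k : ℝ) + 1) ^ (2 * n)

lemma riemannZeta_two_mul_eq_zetaEven (n : ℕ) : riemannZeta (2 * n) = (zetaEven n : ℂ) := by
  rcases eq_or_ne n 0 with rfl | hn
  · simp [zetaEven, riemannZeta_zero]
  · have h := zeta_nat_eq_tsum_of_gt_one (k := 2 * n) (by omega)
    have hs : Summable fun k : ℕ => 1 / (k : ℝ) ^ (2 * n) :=
      Real.summable_one_div_nat_pow.2 (by omega)
    have h' : (∑' k : ℕ, 1 / (k : ℂ) ^ (2 * n)) = ((∑' k : ℕ, 1 / (k : ℝ) ^ (2 * n) : ℝ) : ℂ) := by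
      push_cast
      rfl
    rw [Nat.cast_mul, Nat.cast_two] at h
    rw [h, h', hs.tsum_eq_zero_add]
    simp [zetaEven, hn]

lemma summable_one_div_succ_pow {p : ℕ} (hp : 1 < p) :
    Summable fun k : ℕ => 1 / ((k : ℝ) + 1) ^ p := by
  simpa using (summable_nat_add_iff 1).2 (Real.summable_one_div_nat_pow.2 hp)

lemma abs_zetaEven_le (n : ℕ) : |zetaEven n| ≤ 1 / 2 + ∑' k : ℕ, 1 / ((k : ℝ) + 1) ^ 2 := by
  have h0 : 0 ≤ ∑' k : ℕ, 1 / ((k : ℝ) + 1) ^ 2 := tsum_nonneg fun k => by positivity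
  rcases eq_or_ne n 0 with rfl | hn
  · simp only [zetaEven, if_true]
    rw [abs_of_neg (by norm_num)]
    linarith
  · simp only [zetaEven, hn, if_false]
    rw [abs_of_nonneg (tsum_nonneg fun k => by positivity)]
    have : ∑' k : ℕ, 1 / ((k : ℝ) + 1) ^ (2 * n) ≤ ∑' k : ℕ, 1 / ((k : ℝ) + 1) ^ 2 := by
      refine (summable_one_div_succ_pow (by omega)).tsum_le_tsum (fun k => ?_)
        (summable_one_div_succ_pow (by omega))
      refine one_div_le_one_div_of_le (by positivity) (pow_le_pow_right₀ ?_ (by omega))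
      linarith [(Nat.cast_nonneg k : (0 : ℝ) ≤ k)]
    linarith

lemma hasSum_cot_real {t : ℝ} (ht0 : 0 < t) (ht1 : t < 1) :
    HasSum (fun k : ℕ => t ^ 2 / (((k : ℝ) + 1) ^ 2 - t ^ 2))
      (1 / 2 - Real.pi * t / 2 * (Real.cos (Real.pi * t) / Real.sin (Real.pi * t))) := by
  have hz : (t : ℂ) ∈ Complex.integerComplement := by
    rintro ⟨n, hn⟩
    have hn' : (n : ℝ) = t := by exact_mod_cast hn
    have h1 : 0 < n := by exact_mod_cast hn' ▸ ht0
    have h2 : n < 1 := by exact_mod_cast hn' ▸ ht1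
    omega
  have h := (summable_cotTerm hz).hasSum
  simp only [cotTerm] at h
  rw [← cot_series_rep' hz] at h
  have h2 := h.mul_left (-(t : ℂ) / 2)
  rw [← Complex.hasSum_ofReal]
  have ht : (t : ℂ) ≠ 0 := by exact_mod_cast ht0.ne'
  convert! h2 using 1
  · funext k
    have hk : (0 : ℝ) ≤ k := Nat.cast_nonneg k
    have e1 : (t : ℂ) - (k + 1) ≠ 0 := by
      have : t - (k + 1) ≠ 0 := by linarith
      exact_mod_cast this
    have e2 : (t : ℂ) + (k + 1) ≠ 0 := by
      have : t + (k + 1) ≠ 0 := by linarith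
      exact_mod_cast this
    have e3 : ((k : ℂ) + 1) ^ 2 - (t : ℂ) ^ 2 ≠ 0 := by
      have := mul_ne_zero (neg_ne_zero.2 e1) e2
      convert! this using 1
      ring
    push_cast
    field_simp
    ring
  · push_cast
    rw [Complex.cot]
    field_simp
    ring

lemma hasSum_zetaEven_mul_pow {t : ℝ} (ht0 : 0 < t) (ht1 : t < 1) :
    HasSum (fun n : ℕ => zetaEven n * t ^ (2 * n))
      (-(Real.pi * t / 2 * (Real.cos (Real.pi * t) / Real.sin (Real.pi * t)))) := by
  have hcol : ∀ k : ℕ, HasSum (fun n : ℕ => t ^ (2 * (n + 1)) * (1 / ((k : ℝ) + 1) ^ (2 * (n + 1))))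
      (t ^ 2 / (((k : ℝ) + 1) ^ 2 - t ^ 2)) := by
    intro k
    have hk : (1 : ℝ) ≤ k + 1 := by linarith [(Nat.cast_nonneg k : (0 : ℝ) ≤ k)]
    have hlt : t ^ 2 < ((k : ℝ) + 1) ^ 2 := pow_lt_pow_left₀ (by linarith) ht0.le (by norm_num)
    have hgeo := (hasSum_geometric_of_lt_one (r := t ^ 2 / ((k : ℝ) + 1) ^ 2) (by positivity)
      ((div_lt_one (by positivity)).2 hlt)).mul_left (t ^ 2 / ((k : ℝ) + 1) ^ 2)
    have hne : ((k : ℝ) + 1) ^ 2 - t ^ 2 ≠ 0 := by linarith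
    convert! hgeo using 1
    · funext n
      rw [← pow_succ', div_pow, ← pow_mul, ← pow_mul, mul_one_div]
    · have : 1 - t ^ 2 / ((k : ℝ) + 1) ^ 2 ≠ 0 := by
        rw [one_sub_div (by positivity)]
        exact div_ne_zero hne (by positivity)
      field_simp
  have hrow : ∀ n : ℕ, HasSum
      (fun k : ℕ => t ^ (2 * (n + 1)) * (1 / ((k : ℝ) + 1) ^ (2 * (n + 1))))
      (zetaEven (n + 1) * t ^ (2 * (n + 1))) := by
    intro n
    rw [mul_comm (zetaEven _), zetaEven, if_neg n.succ_ne_zero]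
    exact (summable_one_div_succ_pow (p := 2 * (n + 1)) (by omega)).hasSum.mul_left _
  have hsum : Summable fun p : ℕ × ℕ =>
      t ^ (2 * (p.2 + 1)) * (1 / ((p.1 : ℝ) + 1) ^ (2 * (p.2 + 1))) := by
    refine (summable_prod_of_nonneg fun p => by positivity).2
      ⟨fun k => (hcol k).summable, ?_⟩
    simpa only [(hcol _).tsum_eq] using (hasSum_cot_real ht0 ht1).summable
  have htot := hsum.hasSum
  rw [(htot.prod_fiberwise hcol).unique (hasSum_cot_real ht0 ht1)] at htot
  have hswap := ((Equiv.prodComm ℕ ℕ).hasSum_iff.2 htot).prod_fiberwise hrow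
  convert! (hasSum_nat_add_iff (f := fun n => zetaEven n * t ^ (2 * n)) 1).1 hswap using 1
  simp [zetaEven]
  ring

/-- The weight `(π/2 - θ) cot θ`. -/
noncomputable def cotWeight (θ : ℝ) : ℝ := (Real.pi / 2 - θ) * (Real.cos θ / Real.sin θ)

lemma measurable_cotWeight : Measurable cotWeight := by
  unfold cotWeight
  fun_prop

lemma cotWeight_nonneg {θ : ℝ} (h0 : 0 ≤ θ) (h1 : θ ≤ Real.pi / 2) : 0 ≤ cotWeight θ :=
  mul_nonneg (by linarith) (div_nonneg (Real.cos_nonneg_of_neg_pi_div_two_le_of_le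
    (by linarith [Real.pi_pos]) h1)
    (Real.sin_nonneg_of_nonneg_of_le_pi h0 (by linarith [Real.pi_pos])))

lemma two_mul_mul_cotWeight_le {θ : ℝ} (h0 : 0 < θ) (h1 : θ ≤ Real.pi / 2) :
    2 * θ * cotWeight θ ≤ Real.pi ^ 2 / 2 := by
  have hpi := Real.pi_pos
  have hs : 0 < Real.sin θ := Real.sin_pos_of_pos_of_lt_pi h0 (by linarith)
  have hc : 0 ≤ Real.cos θ :=
    Real.cos_nonneg_of_neg_pi_div_two_le_of_le (by linarith) h1
  have hq : θ / Real.sin θ ≤ Real.pi / 2 := by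
    rw [div_le_iff₀ hs]
    have := mul_le_mul_of_nonneg_left (Real.mul_le_sin h0.le h1) (by positivity : 0 ≤ Real.pi / 2)
    calc θ = Real.pi / 2 * (2 / Real.pi * θ) := by field_simp
      _ ≤ _ := this
  have hprod : (Real.pi / 2 - θ) * Real.cos θ ≤ Real.pi / 2 * 1 :=
    mul_le_mul (by linarith) (Real.cos_le_one θ) hc (by positivity)
  calc 2 * θ * cotWeight θ
      = 2 * (((Real.pi / 2 - θ) * Real.cos θ) * (θ / Real.sin θ)) := by
        rw [cotWeight]; ring
    _ ≤ 2 * ((Real.pi / 2 * 1) * (Real.pi / 2)) := by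
        refine mul_le_mul_of_nonneg_left ?_ (by norm_num)
        exact mul_le_mul hprod hq (by positivity) (by positivity)
    _ = Real.pi ^ 2 / 2 := by ring

lemma sin_pow_mul_cotWeight (k : ℕ) (θ : ℝ) : Real.sin θ ^ (2 * k + 2) * cotWeight θ =
    (Real.pi / 2 - θ) * (Real.sin θ ^ (2 * k + 1) * Real.cos θ) := by
  rw [cotWeight]
  rcases eq_or_ne (Real.sin θ) 0 with h | h
  · simp [h]
  · field_simp
    ring

lemma integral_sin_pow_mul_cotWeight (k : ℕ) :
    ∫ θ in (0 : ℝ)..Real.pi / 2, Real.sin θ ^ (2 * k + 2) * cotWeight θ =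
      (∫ θ in (0 : ℝ)..Real.pi / 2, Real.sin θ ^ (2 * k + 2)) / (2 * k + 2) := by
  simp only [sin_pow_mul_cotWeight]
  have hu : ∀ x ∈ Set.uIcc 0 (Real.pi / 2),
      HasDerivAt (fun x : ℝ => Real.pi / 2 - x) (-1) x := fun x _ => by
    simpa using (hasDerivAt_id x).const_sub (Real.pi / 2)
  have hv : ∀ x ∈ Set.uIcc 0 (Real.pi / 2),
      HasDerivAt (fun x : ℝ => Real.sin x ^ (2 * k + 2) / (2 * k + 2))
        (Real.sin x ^ (2 * k + 1) * Real.cos x) x := fun x _ => by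
    convert! ((Real.hasDerivAt_sin x).fun_pow (2 * k + 2)).div_const (2 * (k : ℝ) + 2) using 1
    push_cast
    field_simp
  rw [intervalIntegral.integral_mul_deriv_eq_deriv_mul hu hv
    (Continuous.intervalIntegrable (by fun_prop) _ _)
    (Continuous.intervalIntegrable (by fun_prop) _ _)]
  simp [intervalIntegral.integral_div]

lemma arcsinCoeff_mul_integral_sin_pow (k : ℕ) :
    arcsinCoeff k * ∫ θ in (0 : ℝ)..Real.pi / 2, Real.sin θ ^ (2 * k + 2) =
      Real.pi / 2 / ((k : ℝ) + 1) ^ 2 := by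
  induction k with
  | zero =>
    rw [integral_sin_pow]
    simp [arcsinCoeff]
  | succ k ih =>
    rw [show 2 * (k + 1) + 2 = (2 * k + 2) + 2 by ring, integral_sin_pow, arcsinCoeff_succ]
    have hk : (k : ℝ) + 1 ≠ 0 := by positivity
    rw [eq_div_iff (by positivity)] at ih
    simp only [Real.sin_zero, Real.cos_pi_div_two, mul_zero, zero_pow (Nat.succ_ne_zero _),
      zero_mul, sub_zero, zero_div, zero_add]
    generalize (∫ θ in (0 : ℝ)..Real.pi / 2, Real.sin θ ^ (2 * k + 2)) = W at ih ⊢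
    rw [eq_div_iff (by positivity), ← ih]
    push_cast
    field_simp
    ring

lemma intervalIntegrable_sin_pow_mul_cotWeight (k : ℕ) :
    IntervalIntegrable (fun θ => Real.sin θ ^ (2 * k + 2) * cotWeight θ) MeasureTheory.volume
      0 (Real.pi / 2) := by
  simp only [sin_pow_mul_cotWeight]
  exact Continuous.intervalIntegrable (by fun_prop) _ _

lemma integral_sinSeries_mul_cotWeight (m N : ℕ) :
    ∫ θ in (0 : ℝ)..Real.pi / 2, sinSeries m N θ * cotWeight θ =
      ∑ k ∈ Finset.range N, Real.pi / 4 * (truncZetaTwos m k / ((k : ℝ) + 1) ^ 3) := by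
  simp only [sinSeries, Finset.sum_mul, mul_assoc]
  rw [intervalIntegral.integral_finsetSum fun k _ =>
    ((intervalIntegrable_sin_pow_mul_cotWeight k).const_mul _).const_mul _]
  refine Finset.sum_congr rfl fun k _ => ?_
  rw [intervalIntegral.integral_const_mul, intervalIntegral.integral_const_mul,
    integral_sin_pow_mul_cotWeight]
  have h := arcsinCoeff_mul_integral_sin_pow k
  rw [eq_div_iff (by positivity)] at h
  have hpi : Real.pi / 4 = (arcsinCoeff k * (∫ θ in (0 : ℝ)..Real.pi / 2,
      Real.sin θ ^ (2 * k + 2)) * ((k : ℝ) + 1) ^ 2) / 2 := by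
    rw [h]; ring
  rw [hpi]
  field_simp

lemma hasSum_truncZetaTwos_div_cube (m : ℕ) :
    HasSum (fun k : ℕ => truncZetaTwos m k / ((k : ℝ) + 1) ^ 3)
      (4 / Real.pi * ∫ θ in (0 : ℝ)..Real.pi / 2,
        (2 * θ) ^ (2 * m + 2) / (2 * m + 2).factorial * cotWeight θ) := by
  have hpi := Real.pi_pos
  have huIoc : Set.uIoc 0 (Real.pi / 2) = Set.Ioc 0 (Real.pi / 2) :=
    Set.uIoc_of_le (by positivity)
  have hlim : Filter.Tendsto
      (fun N => ∫ θ in (0 : ℝ)..Real.pi / 2, sinSeries m N θ * cotWeight θ) Filter.atTop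
      (nhds (∫ θ in (0 : ℝ)..Real.pi / 2,
        (2 * θ) ^ (2 * m + 2) / (2 * m + 2).factorial * cotWeight θ)) := by
    refine intervalIntegral.tendsto_integral_filter_of_dominated_convergence
      (fun θ => (2 * θ) ^ (2 * m + 1) / (2 * m + 2).factorial * (Real.pi ^ 2 / 2))
      (Filter.Eventually.of_forall fun N => ?_) (Filter.Eventually.of_forall fun N => ?_)
      (Continuous.intervalIntegrable (by fun_prop) _ _) ?_
    · refine Measurable.aestronglyMeasurable (Measurable.mul ?_ measurable_cotWeight)
      unfold sinSeries
      fun_prop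
    · refine Filter.Eventually.of_forall fun θ hθ => ?_
      rw [huIoc] at hθ
      have hw := cotWeight_nonneg hθ.1.le hθ.2
      have hR := sinRemainder_nonneg m N hθ.1.le hθ.2
      rw [sinRemainder] at hR
      rw [Real.norm_of_nonneg (mul_nonneg (sinSeries_nonneg m N θ) hw)]
      have hθ0 := hθ.1
      calc sinSeries m N θ * cotWeight θ
          ≤ (2 * θ) ^ (2 * m + 2) / (2 * m + 2).factorial * cotWeight θ :=
            mul_le_mul_of_nonneg_right (by linarith) hw
        _ = (2 * θ) ^ (2 * m + 1) / (2 * m + 2).factorial * (2 * θ * cotWeight θ) := by ring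
        _ ≤ _ := mul_le_mul_of_nonneg_left (two_mul_mul_cotWeight_le hθ.1 hθ.2) (by positivity)
    · have hne : ∀ᵐ θ : ℝ, θ ≠ Real.pi / 2 := by
        simp [MeasureTheory.ae_iff, MeasureTheory.measure_singleton]
      filter_upwards [hne] with θ hθne hθ
      rw [huIoc] at hθ
      have h := (tendsto_sinRemainder m hθ.1.le (lt_of_le_of_ne hθ.2 hθne)).const_sub
        ((2 * θ) ^ (2 * m + 2) / (2 * m + 2).factorial)
      simp only [sinRemainder, sub_sub_cancel, sub_zero] at h
      exact h.mul_const _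
  rw [hasSum_iff_tendsto_nat_of_nonneg fun k =>
    div_nonneg (truncZetaTwos_nonneg m k) (by positivity)]
  convert! hlim.const_mul (4 / Real.pi) using 1
  funext N
  rw [integral_sinSeries_mul_cotWeight, ← Finset.mul_sum]
  field_simp

lemma integral_pow_mul_one_sub (p : ℕ) :
    ∫ x in (0 : ℝ)..1, x ^ (p + 1) * (1 - x) = 1 / (((p : ℝ) + 2) * (p + 3)) := by
  have h : ∀ x : ℝ, x ^ (p + 1) * (1 - x) = x ^ (p + 1) - x ^ (p + 2) := fun x => by ring
  simp only [h]
  rw [intervalIntegral.integral_sub (Continuous.intervalIntegrable (by fun_prop) _ _)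
    (Continuous.intervalIntegrable (by fun_prop) _ _), integral_pow, integral_pow]
  push_cast
  field_simp
  simp
  ring

lemma hasSum_zetaEven_div (r : ℕ) :
    HasSum (fun n : ℕ => zetaEven n /
        (((2 * n + 2 * r + 2 : ℕ) : ℝ) * ((2 * n + 2 * r + 3 : ℕ) : ℝ) * 2 ^ (2 * n)))
      (∫ x in (0 : ℝ)..1, x ^ (2 * r + 1) * (1 - x) *
        -(Real.pi * (x / 2) / 2 *
          (Real.cos (Real.pi * (x / 2)) / Real.sin (Real.pi * (x / 2))))) := by
  have huIoc : Set.uIoc (0 : ℝ) 1 = Set.Ioc 0 1 := Set.uIoc_of_le zero_le_one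
  set K : ℝ := 1 / 2 + ∑' k : ℕ, 1 / ((k : ℝ) + 1) ^ 2
  have h := intervalIntegral.hasSum_integral_of_dominated_convergence
    (μ := MeasureTheory.volume) (a := 0) (b := 1)
    (F := fun n x => x ^ (2 * r + 1) * (1 - x) * (zetaEven n * (x / 2) ^ (2 * n)))
    (f := fun x => x ^ (2 * r + 1) * (1 - x) *
        -(Real.pi * (x / 2) / 2 *
          (Real.cos (Real.pi * (x / 2)) / Real.sin (Real.pi * (x / 2)))))
    (fun n _ => K * (1 / 4) ^ n)
    (fun n => (Continuous.aestronglyMeasurable (by fun_prop)))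
    (fun n => Filter.Eventually.of_forall fun x hx => ?_)
    (Filter.Eventually.of_forall fun x _ =>
      (summable_geometric_of_lt_one (by norm_num) (by norm_num)).mul_left K)
    (by simp) (Filter.Eventually.of_forall fun x hx => ?_)
  · convert! h using 1
    funext n
    have e : ∀ x : ℝ, x ^ (2 * r + 1) * (1 - x) * (zetaEven n * (x / 2) ^ (2 * n)) =
        zetaEven n / 2 ^ (2 * n) * (x ^ (2 * n + 2 * r + 1) * (1 - x)) := by
      intro x
      rw [div_pow]
      ring
    simp only [e]
    rw [intervalIntegral.integral_const_mul, integral_pow_mul_one_sub]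
    push_cast
    field_simp
  · rw [huIoc] at hx
    have hx0 := hx.1.le
    have h1x : 0 ≤ 1 - x := by linarith [hx.2]
    rw [norm_mul, norm_mul, Real.norm_of_nonneg (by positivity : 0 ≤ x ^ (2 * r + 1)),
      Real.norm_of_nonneg h1x, Real.norm_eq_abs, abs_mul,
      abs_of_nonneg (by positivity : 0 ≤ (x / 2) ^ (2 * n))]
    have h1 : x ^ (2 * r + 1) * (1 - x) ≤ 1 :=
      mul_le_one₀ (pow_le_one₀ hx0 hx.2) h1x (by linarith)
    have h2 : (x / 2) ^ (2 * n) ≤ (1 / 4) ^ n := by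
      rw [pow_mul]
      refine pow_le_pow_left₀ (by positivity) ?_ n
      nlinarith [hx.2]
    calc _ ≤ 1 * (K * (1 / 4) ^ n) := by
          have hK0 : 0 ≤ K := (abs_nonneg _).trans (abs_zetaEven_le n)
          exact mul_le_mul h1 (mul_le_mul (abs_zetaEven_le n) h2 (by positivity) hK0)
            (by positivity) zero_le_one
      _ = _ := one_mul _
  · rw [huIoc] at hx
    exact (hasSum_zetaEven_mul_pow (by linarith [hx.1]) (by linarith [hx.2])).mul_left _

lemma integral_cotWeight_eq (r : ℕ) :
    ∫ x in (0 : ℝ)..1, x ^ (2 * r + 1) * (1 - x) *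
        -(Real.pi * (x / 2) / 2 *
          (Real.cos (Real.pi * (x / 2)) / Real.sin (Real.pi * (x / 2)))) =
      -((2 * r + 2).factorial / Real.pi ^ (2 * r + 3)) * ∫ θ in (0 : ℝ)..Real.pi / 2,
        (2 * θ) ^ (2 * r + 2) / (2 * r + 2).factorial * cotWeight θ := by
  have hpi := Real.pi_ne_zero
  have h := intervalIntegral.integral_comp_mul_left (a := 0) (b := 1)
    (fun θ : ℝ => (2 * θ) ^ (2 * r + 2) / (2 * r + 2).factorial * cotWeight θ)
    (c := Real.pi / 2) (by positivity)
  rw [mul_zero, mul_one, smul_eq_mul, eq_comm, inv_mul_eq_iff_eq_mul₀ (by positivity)] at h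
  rw [h, ← mul_assoc, ← intervalIntegral.integral_const_mul]
  refine intervalIntegral.integral_congr fun x _ => ?_
  have e : Real.pi / 2 * x = Real.pi * (x / 2) := by ring
  have e2 : (2 * (Real.pi * (x / 2))) ^ (2 * r + 2) = Real.pi ^ (2 * r + 2) * x ^ (2 * r + 2) := by
    rw [← mul_pow]
    ring
  simp only [cotWeight, e, e2]
  have hf : ((2 * r + 2).factorial : ℝ) ≠ 0 := by positivity
  generalize Real.cos (Real.pi * (x / 2)) / Real.sin (Real.pi * (x / 2)) = c
  field_simp
  ring

theorem stmt_18 (r : ℕ) :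
    (MZV (List.replicate r 2 ++ [3]) : ℂ) =
      (-4 * (Real.pi : ℂ) ^ (2 * r + 2) / (Nat.factorial (2 * r + 2) : ℂ)) *
        ∑' n : ℕ, riemannZeta (2 * n) /
          (((2 * n + 2 * r + 2 : ℕ) : ℂ) * ((2 * n + 2 * r + 3 : ℕ) : ℂ) * 2 ^ (2 * n)) := by
  have hreal : MZV (List.replicate r 2 ++ [3]) =
      (-4 * Real.pi ^ (2 * r + 2) / ((2 * r + 2).factorial : ℝ)) * ∑' n : ℕ, zetaEven n /
        (((2 * n + 2 * r + 2 : ℕ) : ℝ) * ((2 * n + 2 * r + 3 : ℕ) : ℝ) * 2 ^ (2 * n)) := by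
    rw [MZV_twos_three r (hasSum_truncZetaTwos_div_cube r), (hasSum_zetaEven_div r).tsum_eq,
      integral_cotWeight_eq]
    have hpi := Real.pi_ne_zero
    have hf : ((2 * r + 2).factorial : ℝ) ≠ 0 := by positivity
    generalize (∫ θ in (0 : ℝ)..Real.pi / 2,
      (2 * θ) ^ (2 * r + 2) / (2 * r + 2).factorial * cotWeight θ) = J
    field_simp
    ring
  rw [hreal]
  simp only [riemannZeta_two_mul_eq_zetaEven]
  push_cast
  rfl
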